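/- arXiv:2109.09816 — 2 statements merged into one kernel-verified Lean document; each statement's English description precedes it below -/
import Mathlib

section
/- Regret bound of the straightforward policy: under the sequential straightforward-policy model there exist constants C > 0 and c ≥ 0 (independent of T) such that for all T ≥ 2 the expected cumulative regret satisfies E[Reg(T)] ≥ C · T/(log T)^c; that is, the expected regret is at least T divided by a polylogarithmic function of T. -/
open MeasureTheory ProbabilityTheory Set

noncomputable section

/-- Standard normal density. -/
def stdPdf (z : ℝ) : ℝ := Real.exp (-z ^ 2 / 2) / Real.sqrt (2 * Real.pi)

/-- Standard normal cdf. -/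
def stdCdf (c : ℝ) : ℝ := ∫ z in Set.Iio c, stdPdf z

/-- Mean of a standard normal truncated to `(c, ∞)`. -/
def truncMeanAbove (c : ℝ) : ℝ :=
  (∫ z in Set.Ioi c, z * stdPdf z) / (∫ z in Set.Ioi c, stdPdf z)

/-- Mean of a standard normal truncated to `(-∞, c)`. -/
def truncMeanBelow (c : ℝ) : ℝ :=
  (∫ z in Set.Iio c, z * stdPdf z) / (∫ z in Set.Iio c, stdPdf z)

/-- Mean of a standard normal truncated to `(a, b)`. -/
def truncMeanBetween (a b : ℝ) : ℝ :=
  (∫ z in Set.Ioo a b, z * stdPdf z) / (∫ z in Set.Ioo a b, stdPdf z)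

/-- Signum, with the (measure-zero) value at `0` set to `-1`. -/
def sgn (x : ℝ) : ℝ := if 0 < x then 1 else -1

/-- The standard normal measure on `ℝ`. -/
def stdNormal : Measure ℝ := gaussianReal 0 1

/-- The joint law of two independent standard normals. -/
def stdNormal2 : Measure (ℝ × ℝ) := stdNormal.prod stdNormal

/-- Uniform measure on `[-1, 1]` (the prior on the state θ). -/
def uniformState : Measure ℝ := (2 : ENNReal)⁻¹ • volume.restrict (Set.Icc (-1 : ℝ) 1)

instance : IsProbabilityMeasure stdNormal := by unfold stdNormal; infer_instance
instance : IsProbabilityMeasure stdNormal2 := by unfold stdNormal2; infer_instance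
/-- Recommender's message under the straightforward policy. -/
def aSt (m x z : ℝ) : ℝ := if 0 < x * m + z then 1 else -1

/-- User's posterior mean of the dynamic payoff under the straightforward policy. -/
def ZSt (m x z : ℝ) : ℝ :=
  if 0 < x * m + z then truncMeanAbove (-(x * m)) else truncMeanBelow (-(x * m))

/-- User's action under the straightforward policy. -/
def bSt (θ m x z : ℝ) : ℝ := if 0 < x * θ + ZSt m x z then 1 else -1

/-- The superior arm. -/
def bStar (θ x z : ℝ) : ℝ := if 0 < x * θ + z then 1 else -1

/-- Per-round regret under the straightforward policy. -/
def regSt (θ m x z : ℝ) : ℝ := if bSt θ m x z = bStar θ x z then 0 else |x * θ + z|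

/-- One-step update of the confidence interval under the straightforward policy. -/
def updSt (θ l u x z : ℝ) : ℝ × ℝ :=
  if bSt θ ((l + u) / 2) x z * sgn x < 0 then
    (l, min u (-(ZSt ((l + u) / 2) x z / x)))
  else
    (max l (-(ZSt ((l + u) / 2) x z / x)), u)

/-- Confidence interval `(l_t, u_t)` of the recommender under the straightforward
policy, starting from `(-1, 1)`, when the state is `θ` and `ω t = (x_t, z_t)`. -/
def stLU (θ : ℝ) (ω : ℕ → ℝ × ℝ) : ℕ → ℝ × ℝ
  | 0 => (-1, 1)
  | t + 1 => updSt θ (stLU θ ω t).1 (stLU θ ω t).2 (ω t).1 (ω t).2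

/-- Cumulative regret over `T` rounds under the straightforward policy. -/
def stCumReg (θ : ℝ) (ω : ℕ → ℝ × ℝ) (T : ℕ) : ℝ :=
  ∑ t ∈ Finset.range T,
    regSt θ (((stLU θ ω t).1 + (stLU θ ω t).2) / 2) (ω t).1 (ω t).2

lemma stdPdf_pos (z : ℝ) : 0 < stdPdf z := by
  unfold stdPdf
  positivity

lemma continuous_stdPdf : Continuous stdPdf := by
  unfold stdPdf
  fun_prop

lemma integrable_stdPdf : Integrable stdPdf := by
  have h := (integrable_exp_neg_mul_sq (b := 1 / 2) (by norm_num)).div_const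
    (Real.sqrt (2 * Real.pi))
  refine h.congr (ae_of_all _ fun z => ?_)
  simp only [stdPdf]
  congr 2
  ring

lemma integrable_mul_stdPdf : Integrable fun z => z * stdPdf z := by
  have h := (integrable_mul_exp_neg_mul_sq (b := 1 / 2) (by norm_num)).div_const
    (Real.sqrt (2 * Real.pi))
  refine h.congr (ae_of_all _ fun z => ?_)
  simp only [stdPdf, mul_div_assoc]
  congr 3
  ring

lemma stdPdf_neg (z : ℝ) : stdPdf (-z) = stdPdf z := by
  simp [stdPdf]

lemma truncMeanBelow_eq_neg (c : ℝ) : truncMeanBelow c = -truncMeanAbove (-c) := by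
  unfold truncMeanBelow truncMeanAbove
  rw [← integral_Iic_eq_integral_Iio, ← integral_Iic_eq_integral_Iio,
    ← integral_comp_neg_Iic, ← integral_comp_neg_Iic]
  simp only [stdPdf_neg, neg_mul, integral_neg, neg_div, neg_neg]

/-- Shifting by at most `1 / (1 + |c|)` near `c` changes the density by a bounded factor. -/
lemma stdPdf_le_shift {c s z : ℝ} (hs : s * (1 + |c|) = 1) (hs0 : 0 < s)
    (hz : z ≤ c + s) : stdPdf z ≤ 9 * stdPdf (z + s) := by
  have hs1 : s ≤ 1 := by nlinarith [abs_nonneg c]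
  have hexp : Real.exp 2 ≤ 9 := by
    have h := Real.exp_one_lt_d9
    have h2 : Real.exp 2 = Real.exp 1 * Real.exp 1 := by rw [← Real.exp_add]; norm_num
    nlinarith [Real.exp_pos 1]
  have hle : Real.exp (-z ^ 2 / 2) ≤ 9 * Real.exp (-(z + s) ^ 2 / 2) := by
    calc Real.exp (-z ^ 2 / 2) ≤ Real.exp (2 + -(z + s) ^ 2 / 2) := by
          apply Real.exp_le_exp.2
          nlinarith [le_abs_self c]
      _ = Real.exp 2 * Real.exp (-(z + s) ^ 2 / 2) := Real.exp_add _ _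
      _ ≤ _ := by gcongr
  unfold stdPdf
  rw [← mul_div_assoc]
  gcongr

/-- The mean of a truncated normal exceeds the truncation point by a definite amount. -/
lemma truncMeanAbove_gap (c : ℝ) : 1 / (10 * (1 + |c|)) ≤ truncMeanAbove c - c := by
  have hc : 0 < 1 + |c| := by positivity
  set s : ℝ := 1 / (1 + |c|) with hs
  have hs0 : 0 < s := by positivity
  have hs1 : s * (1 + |c|) = 1 := by rw [hs]; field_simp
  set A := ∫ z in Set.Ioc c (c + s), stdPdf z with hA
  set B := ∫ z in Set.Ioi (c + s), stdPdf z with hB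
  set Q := ∫ z in Set.Ioi c, stdPdf z with hQ
  have hi := integrable_stdPdf
  have hshift : Integrable fun z => stdPdf (z + s) := hi.comp_add_right s
  have hQAB : Q = A + B := by
    rw [hQ, hA, hB, ← setIntegral_union (Set.Ioc_disjoint_Ioi le_rfl) measurableSet_Ioi
      hi.integrableOn hi.integrableOn, Set.Ioc_union_Ioi_eq_Ioi (by linarith)]
  have hB' : B = ∫ z in Set.Ioi c, stdPdf (z + s) := by
    rw [hB, ← integral_indicator measurableSet_Ioi, ← integral_indicator measurableSet_Ioi,
      ← integral_add_right_eq_self _ s]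
    congr 1 with z
    simp only [Set.indicator_apply, Set.mem_Ioi, add_lt_add_iff_right]
  have hAB : A ≤ 9 * B := by
    calc A ≤ ∫ z in Set.Ioc c (c + s), 9 * stdPdf (z + s) :=
          setIntegral_mono_on hi.integrableOn (hshift.const_mul 9).integrableOn
            measurableSet_Ioc fun z hz => stdPdf_le_shift hs1 hs0 hz.2
      _ = 9 * ∫ z in Set.Ioc c (c + s), stdPdf (z + s) := integral_const_mul _ _
      _ ≤ 9 * B := by
          rw [hB']
          refine mul_le_mul_of_nonneg_left ?_ (by norm_num)
          exact setIntegral_mono_set hshift.integrableOn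
            (ae_of_all _ fun z => (stdPdf_pos (z + s)).le) Set.Ioc_subset_Ioi_self.eventuallyLE
  have hBpos : 0 < B := by
    rw [hB, setIntegral_pos_iff_support_of_nonneg_ae
      (ae_of_all _ fun z => (stdPdf_pos _).le) hi.integrableOn]
    have : Function.support stdPdf = Set.univ := by
      ext z
      simp [(stdPdf_pos z).ne']
    simp [this]
  have hApos : 0 ≤ A := setIntegral_nonneg measurableSet_Ioc fun z _ => (stdPdf_pos z).le
  have hQpos : 0 < Q := by linarith
  have hint : Integrable fun z => (z - c) * stdPdf z := by
    simpa only [sub_mul] using! integrable_mul_stdPdf.sub (hi.const_mul c)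
  have hN : (∫ z in Set.Ioi c, z * stdPdf z) - c * Q = ∫ z in Set.Ioi c, (z - c) * stdPdf z := by
    simp only [sub_mul]
    rw [integral_sub integrable_mul_stdPdf.integrableOn (hi.const_mul c).integrableOn,
      integral_const_mul]
  have hNB : s * B ≤ ∫ z in Set.Ioi c, (z - c) * stdPdf z := by
    calc s * B = ∫ z in Set.Ioi (c + s), s * stdPdf z := (integral_const_mul _ _).symm
      _ ≤ ∫ z in Set.Ioi (c + s), (z - c) * stdPdf z := by
          refine setIntegral_mono_on (hi.const_mul s).integrableOn hint.integrableOn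
            measurableSet_Ioi fun z hz => ?_
          have hz' : c + s < z := hz
          exact mul_le_mul_of_nonneg_right (by linarith) (stdPdf_pos z).le
      _ ≤ _ := by
          refine setIntegral_mono_set hint.integrableOn ?_
            (Set.Ioi_subset_Ioi (by linarith)).eventuallyLE
          refine (ae_restrict_iff' measurableSet_Ioi).2 (ae_of_all _ fun z hz => ?_)
          exact mul_nonneg (sub_nonneg.2 (le_of_lt hz)) (stdPdf_pos z).le
  have hgoal : 1 / (10 * (1 + |c|)) = s / 10 := by rw [hs]; field_simp
  rw [hgoal, truncMeanAbove, ← hQ, le_sub_iff_add_le, le_div_iff₀ hQpos]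
  nlinarith

lemma ZSt_pos_gap {m x z : ℝ} (h : 0 < x * m + z) :
    1 / (10 * (1 + |x * m|)) ≤ x * m + ZSt m x z := by
  have := truncMeanAbove_gap (-(x * m))
  rw [abs_neg] at this
  rw [ZSt, if_pos h]
  linarith

lemma ZSt_nonpos_gap {m x z : ℝ} (h : ¬ 0 < x * m + z) :
    x * m + ZSt m x z ≤ -(1 / (10 * (1 + |x * m|))) := by
  have := truncMeanAbove_gap (x * m)
  rw [ZSt, if_neg h, truncMeanBelow_eq_neg, neg_neg]
  linarith

/-- The cut `-Z / x` stays away from the midpoint `m`. -/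
lemma cut_gap {m x z L : ℝ} (hm : |m| ≤ 1) (hx : x ≠ 0) (hL : 1 ≤ L) (hxL : |x| ≤ L) :
    1 / (20 * L ^ 2) ≤ |-(ZSt m x z / x) - m| := by
  have hxm : |x * m| ≤ L := by
    rw [abs_mul]
    nlinarith [abs_nonneg x, abs_nonneg m]
  have hx0 : 0 < |x| := abs_pos.2 hx
  have hkey : 1 / (20 * L) ≤ |x * m + ZSt m x z| := by
    have h1 : 1 / (20 * L) ≤ 1 / (10 * (1 + |x * m|)) :=
      one_div_le_one_div_of_le (by positivity) (by linarith)
    by_cases h : 0 < x * m + z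
    · exact (h1.trans (ZSt_pos_gap h)).trans (le_abs_self _)
    · have := ZSt_nonpos_gap h
      exact h1.trans ((le_neg.1 this).trans (neg_le_abs _))
  have heq : -(ZSt m x z / x) - m = -((x * m + ZSt m x z) / x) := by
    field_simp
    ring
  rw [heq, abs_neg, abs_div, le_div_iff₀ hx0]
  refine le_trans ?_ hkey
  calc 1 / (20 * L ^ 2) * |x| ≤ 1 / (20 * L ^ 2) * L := by gcongr
    _ = 1 / (20 * L) := by field_simp

lemma sgn_of_pos {x : ℝ} (h : 0 < x) : sgn x = 1 := if_pos h

lemma sgn_of_neg {x : ℝ} (h : x < 0) : sgn x = -1 := if_neg h.not_gt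

/-- Interval update that keeps the half containing the midpoint of the current interval. -/
def wideStep (I : ℝ × ℝ) (y : ℝ × ℝ) : ℝ × ℝ :=
  if -(ZSt ((I.1 + I.2) / 2) y.1 y.2 / y.1) ≤ (I.1 + I.2) / 2 then
    (max I.1 (-(ZSt ((I.1 + I.2) / 2) y.1 y.2 / y.1)), I.2)
  else (I.1, min I.2 (-(ZSt ((I.1 + I.2) / 2) y.1 y.2 / y.1)))

/-- Trajectory of confidence intervals that always keeps the wider part after a cut. -/
def wideLU (ω : ℕ → ℝ × ℝ) : ℕ → ℝ × ℝ
  | 0 => (-1, 1)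
  | t + 1 => wideStep (wideLU ω t) (ω t)

lemma wideLU_congr {ω ω' : ℕ → ℝ × ℝ} {t : ℕ} (h : ∀ s < t, ω s = ω' s) :
    wideLU ω t = wideLU ω' t := by
  induction t with
  | zero => rfl
  | succ t ih => rw [wideLU, wideLU, ih fun s hs => h s (by omega), h t (by omega)]

lemma wideStep_subset (I y : ℝ × ℝ) :
    Set.Ioo (wideStep I y).1 (wideStep I y).2 ⊆ Set.Ioo I.1 I.2 := by
  unfold wideStep
  split_ifs
  · exact Set.Ioo_subset_Ioo (le_max_left _ _) le_rfl
  · exact Set.Ioo_subset_Ioo le_rfl (min_le_left _ _)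

lemma updSt_eq_wideStep {θ : ℝ} {I y : ℝ × ℝ} (hy : y.1 ≠ 0)
    (hθ : θ ∈ Set.Ioo (wideStep I y).1 (wideStep I y).2) :
    updSt θ I.1 I.2 y.1 y.2 = wideStep I y := by
  unfold wideStep at hθ ⊢
  unfold updSt bSt
  set m := (I.1 + I.2) / 2
  set Z := ZSt m y.1 y.2
  have hcut : Z = -(y.1 * -(Z / y.1)) := by field_simp
  set k := -(Z / y.1)
  rw [hcut]
  rcases lt_or_gt_of_ne hy with hneg | hpos
  · rw [sgn_of_neg hneg]
    split_ifs at hθ ⊢ with h1 h2 h3 h3 <;> first | rfl | exfalso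
    all_goals simp only [Set.mem_Ioo, max_lt_iff, lt_min_iff] at hθ
    all_goals first | (norm_num at *; done) | nlinarith
  · rw [sgn_of_pos hpos]
    split_ifs at hθ ⊢ with h1 h2 h3 h3 <;> first | rfl | exfalso
    all_goals simp only [Set.mem_Ioo, max_lt_iff, lt_min_iff] at hθ
    all_goals first | (norm_num at *; done) | nlinarith

lemma stLU_eq_wideLU {θ : ℝ} {ω : ℕ → ℝ × ℝ} {t : ℕ} (hω : ∀ s < t, (ω s).1 ≠ 0)
    (hθ : θ ∈ Set.Ioo (wideLU ω t).1 (wideLU ω t).2) : stLU θ ω t = wideLU ω t := by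
  induction t with
  | zero => rfl
  | succ t ih =>
    have h := ih (fun s hs => hω s (by omega)) (wideStep_subset _ _ hθ)
    rw [stLU, h]
    exact updSt_eq_wideStep (hω t (by omega)) hθ

/-- As long as the contexts are bounded by `L`, the wide trajectory never becomes
shorter than `1 / (20 L²)`. -/
lemma wideLU_width {ω : ℕ → ℝ × ℝ} {t : ℕ} {L : ℝ} (hL : 1 ≤ L)
    (hω : ∀ s < t, (ω s).1 ≠ 0 ∧ |(ω s).1| ≤ L) :
    -1 ≤ (wideLU ω t).1 ∧ (wideLU ω t).2 ≤ 1 ∧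
      1 / (20 * L ^ 2) ≤ (wideLU ω t).2 - (wideLU ω t).1 := by
  induction t with
  | zero =>
    simp only [wideLU, le_refl, true_and]
    rw [div_le_iff₀ (by positivity)]
    nlinarith
  | succ t ih =>
    obtain ⟨h1, h2, h3⟩ := ih fun s hs => hω s (by omega)
    obtain ⟨hx, hxL⟩ := hω t (by omega)
    rw [wideLU, wideStep]
    have hδ : 0 < 1 / (20 * L ^ 2) := by positivity
    set δ := 1 / (20 * L ^ 2)
    set I := wideLU ω t
    have hm : |(I.1 + I.2) / 2| ≤ 1 := abs_le.2 ⟨by linarith, by linarith⟩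
    have hgap := cut_gap (z := (ω t).2) hm hx hL hxL
    set k := -(ZSt ((I.1 + I.2) / 2) (ω t).1 (ω t).2 / (ω t).1)
    split_ifs with h
    · rw [abs_of_nonpos (by linarith)] at hgap
      refine ⟨le_max_of_le_left h1, h2, ?_⟩
      rcases max_cases I.1 k with hc | hc <;> simp only [hc.1] <;> linarith
    · rw [abs_of_pos (by linarith)] at hgap
      refine ⟨h1, min_le_of_left_le h2, ?_⟩
      rcases min_cases I.2 k with hc | hc <;> simp only [hc.1] <;> linarith

lemma regSt_nonneg (θ m x z : ℝ) : 0 ≤ regSt θ m x z := by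
  unfold regSt
  split_ifs <;> positivity

/-- A region of payoffs in which the user suffers regret. -/
lemma le_regSt {θ m x z w η : ℝ} (hm : |m| ≤ 1) (hw : w ≤ 2)
    (hx : x ∈ Set.Ioo (1 / 40 : ℝ) (1 / 20)) (hη : 320 * η ≤ w) (hη0 : 0 < η)
    (hθ : θ ∈ Set.Ioo (m + w / 4) (m + w / 2))
    (hz : z ∈ Set.Ioo (-(x * m) - η) (-(x * m))) : η ≤ regSt θ m x z := by
  obtain ⟨hx1, hx2⟩ := hx
  obtain ⟨hθ1, hθ2⟩ := hθ
  obtain ⟨hz1, hz2⟩ := hz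
  have hreg : η ≤ x * θ + z := by nlinarith
  have hbs : bStar θ x z = 1 := if_pos (by linarith)
  have hxm : |x * m| ≤ 1 / 20 := by
    rw [abs_mul, abs_of_pos (by linarith : 0 < x)]
    nlinarith [abs_nonneg m]
  have hgap := ZSt_nonpos_gap (m := m) (x := x) (z := z) (by linarith)
  have h20 : 1 / 20 ≤ 1 / (10 * (1 + |x * m|)) :=
    one_div_le_one_div_of_le (by positivity) (by linarith)
  have hb : bSt θ m x z = -1 := if_neg (by nlinarith)
  rw [regSt, hbs, hb, if_neg (by norm_num)]
  exact hreg.trans (le_abs_self _)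

lemma mul_le_prod_of_forall_section {α β : Type*} [MeasurableSpace α] [MeasurableSpace β]
    (μ : Measure α) (ν : Measure β) [SFinite ν] {S : Set (α × β)} {A : Set α} {ε : ENNReal}
    (h : ∀ a ∈ A, ε ≤ ν {b | (a, b) ∈ S}) : ε * μ A ≤ μ.prod ν S := by
  rw [← measure_toMeasurable S, Measure.prod_apply (measurableSet_toMeasurable _ _)]
  refine le_trans ?_ (mul_meas_ge_le_lintegral
    (measurable_measure_prodMk_left (measurableSet_toMeasurable _ _)) ε)
  gcongr
  intro a ha
  exact (h a ha).trans (measure_mono fun b hb => subset_toMeasurable _ _ hb)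

lemma mul_le_prod_of_forall_section_symm {α β : Type*} [MeasurableSpace α] [MeasurableSpace β]
    (μ : Measure α) (ν : Measure β) [SFinite μ] [SFinite ν] {S : Set (α × β)} {B : Set β}
    {ε : ENNReal} (h : ∀ b ∈ B, ε ≤ μ {a | (a, b) ∈ S}) : ε * ν B ≤ μ.prod ν S := by
  rw [← measure_toMeasurable S, Measure.prod_apply_symm (measurableSet_toMeasurable _ _)]
  refine le_trans ?_ (mul_meas_ge_le_lintegral
    (measurable_measure_prodMk_right (measurableSet_toMeasurable _ _)) ε)
  gcongr
  intro b hb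
  exact (h b hb).trans (measure_mono fun a ha => subset_toMeasurable _ _ ha)

lemma stdPdf_eq_gaussianPDFReal (z : ℝ) : stdPdf z = gaussianPDFReal 0 1 z := by
  simp [stdPdf, gaussianPDFReal, div_eq_inv_mul]

lemma ofReal_le_stdNormal_Ioo {a b : ℝ} (ha : -2 ≤ a) (hb : b ≤ 2) (hab : a ≤ b) :
    ENNReal.ofReal (stdPdf 2 * (b - a)) ≤ stdNormal (Set.Ioo a b) := by
  rw [stdNormal, gaussianReal_apply_eq_integral 0 one_ne_zero]
  apply ENNReal.ofReal_le_ofReal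
  simp only [← stdPdf_eq_gaussianPDFReal]
  have h : ∫ _ in Set.Ioo a b, stdPdf 2 = stdPdf 2 * (b - a) := by
    simp [hab, mul_comm]
  rw [← h]
  refine setIntegral_mono_on (integrable_const _) integrable_stdPdf.integrableOn
    measurableSet_Ioo fun z hz => ?_
  unfold stdPdf
  have : z ^ 2 ≤ 2 ^ 2 := sq_le_sq' (by linarith [hz.1]) (by linarith [hz.2])
  gcongr

instance : IsProbabilityMeasure uniformState :=
  ⟨by
    simp only [uniformState, Measure.smul_apply, Measure.restrict_apply_univ, Real.volume_Icc,
      smul_eq_mul]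
    norm_num
    exact ENNReal.inv_mul_cancel two_ne_zero (by simp)⟩

lemma ofReal_le_uniformState_Ioo {a b : ℝ} (ha : -1 ≤ a) (hb : b ≤ 1) :
    ENNReal.ofReal ((b - a) / 2) ≤ uniformState (Set.Ioo a b) := by
  rw [uniformState, Measure.smul_apply, Measure.restrict_apply measurableSet_Ioo,
    Set.inter_eq_left.2 (Set.Ioo_subset_Icc_self.trans (Set.Icc_subset_Icc ha hb)),
    Real.volume_Ioo, smul_eq_mul, ENNReal.ofReal_div_of_pos two_pos, ENNReal.div_eq_inv_mul]
  simp

lemma stdNormal_tail (L : ℝ) :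
    stdNormal.real {x | L ≤ x} ≤ Real.exp (1 / 2 - L) := by
  have h := measure_ge_le_exp_mul_mgf (μ := stdNormal) (X := id) (t := 1) L zero_le_one
    (by simpa [stdNormal] using integrable_exp_mul_gaussianReal (μ := 0) (v := 1) 1)
  rw [mgf_gaussianReal (μ := 0) (v := 1) (by simp [stdNormal]), ← Real.exp_add] at h
  refine h.trans (le_of_eq ?_)
  norm_num
  ring

lemma stdNormal_tail_neg (L : ℝ) :
    stdNormal.real {x | x ≤ -L} ≤ Real.exp (1 / 2 - L) := by
  have hmap : stdNormal.map (fun x => -x) = stdNormal := by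
    simp [stdNormal, gaussianReal_map_neg]
  refine le_trans (le_of_eq ?_) (stdNormal_tail L)
  have h := map_measureReal_apply (μ := stdNormal) measurable_neg
    (measurableSet_Ici (a := L))
  rw [show (Neg.neg : ℝ → ℝ) = fun x => -x from rfl, hmap] at h
  refine Eq.trans ?_ h.symm
  congr 1
  ext x
  simp

/-- Contexts that are bounded by `L` and nonzero have overwhelming probability. -/
lemma stdNormal2_bounded (L : ℝ) :
    ENNReal.ofReal (1 - 2 * Real.exp (1 / 2 - L)) ≤
      stdNormal2 {y | y.1 ≠ 0 ∧ |y.1| ≤ L} := by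
  have hset : {y : ℝ × ℝ | y.1 ≠ 0 ∧ |y.1| ≤ L} =
      {x : ℝ | x ≠ 0 ∧ |x| ≤ L} ×ˢ Set.univ := by
    ext y
    simp
  rw [hset, stdNormal2, Measure.prod_prod, measure_univ, mul_one, ← ofReal_measureReal]
  apply ENNReal.ofReal_le_ofReal
  have hcompl : {x : ℝ | x ≠ 0 ∧ |x| ≤ L}ᶜ ⊆ {0} ∪ ({x | L ≤ x} ∪ {x | x ≤ -L}) := by
    intro x hx
    by_contra hcon
    simp only [Set.mem_union, Set.mem_singleton_iff, Set.mem_ofPred_eq, not_or, not_le] at hcon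
    exact hx ⟨hcon.1, abs_le.2 ⟨hcon.2.2.le, hcon.2.1.le⟩⟩
  have hmeas : MeasurableSet {x : ℝ | x ≠ 0 ∧ |x| ≤ L} :=
    (measurableSet_singleton 0).compl.inter (measurableSet_le measurable_norm measurable_const)
  have hzero : stdNormal.real {0} = 0 := by
    have : NullSingletonClass stdNormal := nullSingletonClass_gaussianReal one_ne_zero
    simp [measureReal_def]
  have h1 := measureReal_mono (μ := stdNormal) hcompl
  have h2 := measureReal_union_le (μ := stdNormal) {0} ({x | L ≤ x} ∪ {x | x ≤ -L})
  have h3 := measureReal_union_le (μ := stdNormal) {x | L ≤ x} {x | x ≤ -L}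
  rw [probReal_compl_eq_one_sub hmeas] at h1
  linarith [stdNormal_tail L, stdNormal_tail_neg L]

/-- Extension of a finite sample by zero. -/
def extendZero {T : ℕ} (v : Fin T → ℝ × ℝ) (t : ℕ) : ℝ × ℝ :=
  if h : t < T then v ⟨t, h⟩ else 0

/-- Regret incurred in round `t`. -/
def roundReg {T : ℕ} (t : ℕ) (p : ℝ × (Fin T → ℝ × ℝ)) : ℝ :=
  regSt p.1 (((stLU p.1 (extendZero p.2) t).1 + (stLU p.1 (extendZero p.2) t).2) / 2)
    (extendZero p.2 t).1 (extendZero p.2 t).2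

lemma extendZero_insertNth_self {n : ℕ} (t : Fin (n + 1)) (y : ℝ × ℝ) (v : Fin n → ℝ × ℝ) :
    extendZero (t.insertNth (α := fun _ => ℝ × ℝ) y v) t = y := by
  simp [extendZero, t.isLt]

lemma extendZero_insertNth_of_lt {n : ℕ} (t : Fin (n + 1)) (y : ℝ × ℝ) (v : Fin n → ℝ × ℝ)
    {s : ℕ} (hs : s < t) :
    extendZero (t.insertNth (α := fun _ => ℝ × ℝ) y v) s = extendZero v s := by
  have hsn : s < n := by omega
  have h : (⟨s, by omega⟩ : Fin (n + 1)) = t.succAbove ⟨s, hsn⟩ := by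
    rw [Fin.succAbove_of_castSucc_lt _ _ (by simpa [Fin.lt_def] using hs)]
    rfl
  rw [extendZero, dif_pos (by omega : s < n + 1), h, Fin.insertNth_apply_succAbove, extendZero,
    dif_pos hsn]

lemma measure_roundReg_ge {n : ℕ} (t : Fin (n + 1)) {L η : ℝ} (hL : 1 ≤ L)
    (hη : 320 * η = 1 / (20 * L ^ 2)) :
    ENNReal.ofReal (40 * η) * ((ENNReal.ofReal (stdPdf 2 * η) * ENNReal.ofReal (stdPdf 2 / 40)) *
      stdNormal2 {y | y.1 ≠ 0 ∧ |y.1| ≤ L} ^ n) ≤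
    uniformState.prod (Measure.pi fun _ : Fin (n + 1) => stdNormal2)
      {p | η ≤ roundReg t p} := by
  have hδ : 0 < 1 / (20 * L ^ 2) := by positivity
  have hη0 : 0 < η := by linarith
  have hη1 : η ≤ 1 := by
    have : 1 / (20 * L ^ 2) ≤ 1 / 20 := one_div_le_one_div_of_le (by norm_num) (by nlinarith)
    linarith
  set mid : (ℕ → ℝ × ℝ) → ℝ := fun ω => ((wideLU ω t).1 + (wideLU ω t).2) / 2 with hmid
  set G : Set (Fin (n + 1) → ℝ × ℝ) := {v | (∀ s < (t : ℕ), (extendZero v s).1 ≠ 0 ∧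
    |(extendZero v s).1| ≤ L) ∧ (extendZero v t).1 ∈ Set.Ioo (1 / 40 : ℝ) (1 / 20) ∧
    (extendZero v t).2 ∈ Set.Ioo (-((extendZero v t).1 * mid (extendZero v)) - η)
      (-((extendZero v t).1 * mid (extendZero v)))} with hG
  have hstate : ENNReal.ofReal (40 * η) * Measure.pi (fun _ : Fin (n + 1) => stdNormal2) G ≤
      uniformState.prod (Measure.pi fun _ : Fin (n + 1) => stdNormal2)
        {p | η ≤ roundReg t p} := by
    refine mul_le_prod_of_forall_section_symm _ _ fun v hv => ?_
    obtain ⟨hpast, hx, hz⟩ := hv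
    obtain ⟨h1, h2, h3⟩ := wideLU_width hL hpast
    set I := wideLU (extendZero v) t
    have hm : |(I.1 + I.2) / 2| ≤ 1 := abs_le.2 ⟨by linarith, by linarith⟩
    have hsub : Set.Ioo ((I.1 + I.2) / 2 + (I.2 - I.1) / 4) I.2 ⊆
        {θ | (θ, v) ∈ {p : ℝ × (Fin (n + 1) → ℝ × ℝ) | η ≤ roundReg t p}} := by
      intro θ hθ
      have hmem : θ ∈ Set.Ioo I.1 I.2 := ⟨by linarith [hθ.1], hθ.2⟩
      have hst : stLU θ (extendZero v) t = I := stLU_eq_wideLU (fun s hs => (hpast s hs).1) hmem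
      simp only [Set.mem_ofPred_eq, roundReg, hst]
      exact le_regSt hm (by linarith) hx (by linarith) hη0
        ⟨hθ.1, by linarith [hθ.2]⟩ hz
    refine le_trans ?_ (measure_mono hsub)
    refine le_trans ?_ (ofReal_le_uniformState_Ioo (by linarith) h2)
    exact ENNReal.ofReal_le_ofReal (by linarith)
  have hsplit : Measure.pi (fun _ : Fin (n + 1) => stdNormal2) G =
      (stdNormal2.prod (Measure.pi fun _ : Fin n => stdNormal2))
        {q | t.insertNth (α := fun _ => ℝ × ℝ) q.1 q.2 ∈ G} := by
    have hmp := (measurePreserving_piFinSuccAbove (fun _ : Fin (n + 1) => stdNormal2) t).symm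
    exact (hmp.measure_preimage_equiv G).symm
  have hpast : stdNormal2 {y | y.1 ≠ 0 ∧ |y.1| ≤ L} ^ n =
      Measure.pi (fun _ : Fin n => stdNormal2)
        (Set.univ.pi fun _ => {y : ℝ × ℝ | y.1 ≠ 0 ∧ |y.1| ≤ L}) := by
    simp [Measure.pi_pi]
  refine le_trans ?_ hstate
  gcongr
  rw [hsplit, hpast]
  refine mul_le_prod_of_forall_section_symm _ _ fun v hv => ?_
  have hv' : ∀ s < (t : ℕ), (extendZero v s).1 ≠ 0 ∧ |(extendZero v s).1| ≤ L := by
    intro s hs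
    have := hv ⟨s, by omega⟩ (Set.mem_univ _)
    simpa [extendZero, (by omega : s < n)] using this
  obtain ⟨h1, h2, h3⟩ := wideLU_width hL hv'
  have hm : |mid (extendZero v)| ≤ 1 := abs_le.2 ⟨by simp only [hmid]; linarith,
    by simp only [hmid]; linarith⟩
  have hmeq : ∀ y : ℝ × ℝ,
      mid (extendZero (t.insertNth (α := fun _ => ℝ × ℝ) y v)) = mid (extendZero v) := by
    intro y
    simp only [hmid]
    rw [wideLU_congr fun s hs => extendZero_insertNth_of_lt t y v hs]
  have hx : ENNReal.ofReal (stdPdf 2 / 40) ≤ stdNormal (Set.Ioo (1 / 40 : ℝ) (1 / 20)) := by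
    refine le_trans (ENNReal.ofReal_le_ofReal ?_)
      (ofReal_le_stdNormal_Ioo (by norm_num) (by norm_num) (by norm_num))
    exact le_of_eq (by ring)
  refine (mul_le_mul_right hx _).trans (mul_le_prod_of_forall_section _ _ fun x hx => ?_)
  have hxm : |x * mid (extendZero v)| ≤ 1 := by
    rw [abs_mul, abs_of_pos (by linarith [hx.1])]
    nlinarith [hx.1, hx.2, abs_nonneg (mid (extendZero v))]
  have hxm' := abs_le.1 hxm
  refine le_trans ?_ (measure_mono (s := Set.Ioo (-(x * mid (extendZero v)) - η)
    (-(x * mid (extendZero v)))) fun z hz => ?_)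
  · refine le_trans (ENNReal.ofReal_le_ofReal ?_)
      (ofReal_le_stdNormal_Ioo (by linarith) (by linarith) (by linarith))
    exact le_of_eq (by ring)
  · simp only [hG, Set.mem_ofPred_eq, extendZero_insertNth_self, hmeq]
    refine ⟨fun s hs => ?_, hx, hz⟩
    rw [extendZero_insertNth_of_lt t _ v hs]
    exact hv' s hs

lemma measurable_truncMeanAbove : Measurable truncMeanAbove := by
  have h : ∀ f : ℝ → ℝ, Measurable f → Measurable fun c => ∫ z in Set.Ioi c, f z := by
    intro f hf
    have hm : StronglyMeasurable fun q : ℝ × ℝ => if q.1 < q.2 then f q.2 else 0 :=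
      (Measurable.ite (measurableSet_lt measurable_fst measurable_snd)
        (hf.comp measurable_snd) measurable_const).stronglyMeasurable
    have heq : (fun c => ∫ z in Set.Ioi c, f z) =
        fun c => ∫ z, if c < z then f z else 0 := by
      funext c
      rw [← integral_indicator measurableSet_Ioi]
      rfl
    rw [heq]
    exact (hm.integral_prod_right' (ν := volume)).measurable
  exact (h _ (measurable_id.mul continuous_stdPdf.measurable)).div
    (h _ continuous_stdPdf.measurable)

lemma measurable_truncMeanBelow : Measurable truncMeanBelow := by
  rw [funext truncMeanBelow_eq_neg]
  exact (measurable_truncMeanAbove.comp measurable_neg).neg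

section Measurability

variable {α : Type*} [MeasurableSpace α] {f g h k : α → ℝ}

lemma Measurable.sgn (hf : Measurable f) : Measurable fun a => sgn (f a) :=
  Measurable.ite (measurableSet_lt measurable_const hf) measurable_const measurable_const

lemma Measurable.ZSt (hf : Measurable f) (hg : Measurable g) (hh : Measurable h) :
    Measurable fun a => ZSt (f a) (g a) (h a) :=
  Measurable.ite (measurableSet_lt measurable_const ((hg.mul hf).add hh))
    (measurable_truncMeanAbove.comp (hg.mul hf).neg)
    (measurable_truncMeanBelow.comp (hg.mul hf).neg)

lemma Measurable.bSt (hk : Measurable k) (hf : Measurable f) (hg : Measurable g)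
    (hh : Measurable h) : Measurable fun a => bSt (k a) (f a) (g a) (h a) :=
  Measurable.ite (measurableSet_lt measurable_const ((hg.mul hk).add (hf.ZSt hg hh)))
    measurable_const measurable_const

lemma Measurable.regSt (hk : Measurable k) (hf : Measurable f) (hg : Measurable g)
    (hh : Measurable h) : Measurable fun a => regSt (k a) (f a) (g a) (h a) :=
  Measurable.ite
    (measurableSet_eq_fun (hk.bSt hf hg hh)
      (Measurable.ite (measurableSet_lt measurable_const ((hg.mul hk).add hh))
        measurable_const measurable_const))
    measurable_const ((hg.mul hk).add hh).norm

lemma Measurable.updSt {I y : α → ℝ × ℝ} (hk : Measurable k) (hI : Measurable I)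
    (hy : Measurable y) : Measurable fun a => updSt (k a) (I a).1 (I a).2 (y a).1 (y a).2 := by
  have hm : Measurable fun a => ((I a).1 + (I a).2) / 2 := (hI.fst.add hI.snd).div_const 2
  have hcut := ((hm.ZSt hy.fst hy.snd).div hy.fst).neg
  exact Measurable.ite
    (measurableSet_lt ((hk.bSt hm hy.fst hy.snd).mul hy.fst.sgn) measurable_const)
    (hI.fst.prodMk (hI.snd.min hcut)) ((hI.fst.max hcut).prodMk hI.snd)

end Measurability

lemma measurable_extendZero {T : ℕ} (t : ℕ) :
    Measurable fun v : Fin T → ℝ × ℝ => extendZero v t := by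
  unfold extendZero
  split_ifs
  · exact measurable_pi_apply _
  · exact measurable_const

lemma measurable_roundReg {T : ℕ} (t : ℕ) :
    Measurable (roundReg t : ℝ × (Fin T → ℝ × ℝ) → ℝ) := by
  have hω : ∀ s, Measurable fun p : ℝ × (Fin T → ℝ × ℝ) => extendZero p.2 s :=
    fun s => (measurable_extendZero s).comp measurable_snd
  have hLU : ∀ s, Measurable fun p : ℝ × (Fin T → ℝ × ℝ) => stLU p.1 (extendZero p.2) s := by
    intro s
    induction s with
    | zero => exact measurable_const
    | succ s ih => exact measurable_fst.updSt ih (hω s)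
  exact measurable_fst.regSt (((hLU t).fst.add (hLU t).snd).div_const 2) (hω t).fst (hω t).snd

lemma integrable_roundReg {T t : ℕ} (ht : t < T) :
    Integrable (roundReg t)
      (uniformState.prod (Measure.pi fun _ : Fin T => stdNormal2)) := by
  have hid : Integrable (fun x : ℝ => |x|) stdNormal :=
    ((memLp_id_gaussianReal' (μ := 0) (v := 1) 1 ENNReal.one_ne_top).integrable le_rfl).abs
  have hdom : Integrable (fun y : ℝ × ℝ => |y.1| + |y.2|) stdNormal2 :=
    (hid.comp_fst stdNormal).add (hid.comp_snd stdNormal)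
  have hpi : Integrable (fun v : Fin T → ℝ × ℝ => |(v ⟨t, ht⟩).1| + |(v ⟨t, ht⟩).2|)
      (Measure.pi fun _ : Fin T => stdNormal2) :=
    (measurePreserving_eval (fun _ : Fin T => stdNormal2) ⟨t, ht⟩).integrable_comp_of_integrable
      hdom
  refine (hpi.comp_snd uniformState).mono' (measurable_roundReg t).aestronglyMeasurable ?_
  have hθ : ∀ᵐ θ ∂uniformState, |θ| ≤ 1 := by
    refine Measure.ae_smul_measure ?_ _
    exact (ae_restrict_iff' measurableSet_Icc).2 (ae_of_all _ fun θ hθ => abs_le.2 hθ)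
  filter_upwards [Measure.quasiMeasurePreserving_fst.ae hθ] with p hp
  simp only [roundReg, extendZero, dif_pos ht]
  rw [Real.norm_of_nonneg (regSt_nonneg _ _ _ _), regSt]
  split_ifs
  · positivity
  · refine (abs_add_le _ _).trans ?_
    refine add_le_add_left ?_ _
    rw [abs_mul]
    exact mul_le_of_le_one_right (abs_nonneg _) hp

lemma bounded_contexts_prob {n : ℕ} (hn : 1 ≤ n) :
    ENNReal.ofReal (1 / 2) ≤
      stdNormal2 {y | y.1 ≠ 0 ∧ |y.1| ≤ 4 * Real.log (n + 1)} ^ n := by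
  have hn1 : (1 : ℝ) ≤ n := by exact_mod_cast hn
  set x : ℝ := n + 1 with hx
  have hx2 : 2 ≤ x := by linarith
  have hexp : 2 * Real.exp (1 / 2 - 4 * Real.log x) ≤ 1 / (2 * x) := by
    have h1 : Real.exp (1 / 2) ≤ 2 := by
      have h := Real.exp_one_lt_d9
      have h2 : Real.exp 1 = Real.exp (1 / 2) * Real.exp (1 / 2) := by
        rw [← Real.exp_add]
        norm_num
      nlinarith [Real.exp_pos (1 / 2)]
    have h4 : Real.exp (4 * Real.log x) = x ^ 4 := by
      rw [mul_comm, Real.exp_mul, Real.exp_log (by linarith)]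
      norm_cast
    have h8 : 8 ≤ x ^ 3 := by
      calc (8 : ℝ) = 2 ^ 3 := by norm_num
        _ ≤ x ^ 3 := by gcongr
    rw [Real.exp_sub, h4, ← mul_div_assoc, div_le_div_iff₀ (by positivity) (by positivity)]
    calc 2 * Real.exp (1 / 2) * (2 * x) ≤ 2 * 2 * (2 * x) := by gcongr
      _ = 8 * x := by ring
      _ ≤ x ^ 3 * x := by gcongr
      _ = 1 * x ^ 4 := by ring
  have hinv : 1 / (2 * x) ≤ 1 / 2 :=
    one_div_le_one_div_of_le (by norm_num) (by linarith)
  calc ENNReal.ofReal (1 / 2)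
      ≤ ENNReal.ofReal ((1 - 2 * Real.exp (1 / 2 - 4 * Real.log x)) ^ n) := by
        apply ENNReal.ofReal_le_ofReal
        have hbern := one_add_mul_le_pow
          (a := -(2 * Real.exp (1 / 2 - 4 * Real.log x))) (by linarith) n
        rw [← sub_eq_add_neg] at hbern
        refine le_trans ?_ hbern
        have : (n : ℝ) * (2 * Real.exp (1 / 2 - 4 * Real.log x)) ≤ x * (1 / (2 * x)) := by
          gcongr
          linarith
        have h12 : x * (1 / (2 * x)) = 1 / 2 := by field_simp
        linarith
    _ = ENNReal.ofReal (1 - 2 * Real.exp (1 / 2 - 4 * Real.log x)) ^ n :=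
        ENNReal.ofReal_pow (by linarith) n
    _ ≤ _ := by
        gcongr
        exact stdNormal2_bounded _

lemma integral_roundReg_ge {n : ℕ} (hn : 1 ≤ n) (t : Fin (n + 1)) :
    stdPdf 2 ^ 2 / (2 * 102400 ^ 3) / Real.log (n + 1) ^ 6 ≤
      ∫ p, roundReg t p ∂(uniformState.prod (Measure.pi fun _ : Fin (n + 1) => stdNormal2)) := by
  have hn1 : (1 : ℝ) ≤ n := by exact_mod_cast hn
  have hlog : 1 / 4 ≤ Real.log (n + 1) := by
    have h := Real.log_two_gt_d9
    have := Real.log_le_log two_pos (by linarith : (2 : ℝ) ≤ n + 1)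
    linarith
  set l := Real.log (n + 1)
  have hl : 0 < l := by linarith
  set η : ℝ := 1 / (102400 * l ^ 2) with hη
  have hη0 : 0 < η := by positivity
  have hκ := stdPdf_pos 2
  have hprob := measure_roundReg_ge t (L := 4 * l) (η := η) (by linarith)
    (by rw [hη]; field_simp; norm_num)
  have hfinal : ENNReal.ofReal (stdPdf 2 ^ 2 * η ^ 2 / 2) ≤
      uniformState.prod (Measure.pi fun _ : Fin (n + 1) => stdNormal2)
        {p | η ≤ roundReg t p} := by
    refine le_trans ?_ hprob
    calc ENNReal.ofReal (stdPdf 2 ^ 2 * η ^ 2 / 2)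
        = ENNReal.ofReal (40 * η) * ((ENNReal.ofReal (stdPdf 2 * η) *
            ENNReal.ofReal (stdPdf 2 / 40)) * ENNReal.ofReal (1 / 2)) := by
          rw [← ENNReal.ofReal_mul (by positivity), ← ENNReal.ofReal_mul (by positivity),
            ← ENNReal.ofReal_mul (by positivity)]
          congr 1
          ring
      _ ≤ _ := by
          gcongr
          exact bounded_contexts_prob hn
  have hreal := (ENNReal.ofReal_le_iff_le_toReal (measure_ne_top _ _)).1 hfinal
  have hmarkov := mul_meas_ge_le_integral_of_nonneg
    (ae_of_all _ fun p => regSt_nonneg _ _ _ _) (integrable_roundReg t.isLt) η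
  refine le_trans ?_ hmarkov
  refine le_trans (le_of_eq ?_) (mul_le_mul_of_nonneg_left hreal hη0.le)
  rw [hη]
  field_simp

/-- **Regret bound of the straightforward policy.** There exist constants `C > 0`
and `c ≥ 0`, independent of `T`, such that for all `T ≥ 2` the expected cumulative
regret (over `θ ~ Unif[-1,1]` and i.i.d. standard normal contexts and dynamic
payoffs) is at least `C * T / (log T) ^ c`. -/
theorem straightforward_cumulative_regret_lower_bound :
    ∃ C c : ℝ, 0 < C ∧ 0 ≤ c ∧
      ∀ T : ℕ, 2 ≤ T →
        C * T / (Real.log T) ^ c ≤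
          ∫ p : ℝ × (Fin T → ℝ × ℝ),
            stCumReg p.1 (fun t => if h : t < T then p.2 ⟨t, h⟩ else 0) T
            ∂(uniformState.prod (Measure.pi fun _ : Fin T => stdNormal2)) := by
  have hκ := stdPdf_pos 2
  refine ⟨stdPdf 2 ^ 2 / (2 * 102400 ^ 3), 6, by positivity, by norm_num, fun T hT => ?_⟩
  obtain ⟨n, rfl⟩ : ∃ n, T = n + 1 := ⟨T - 1, by omega⟩
  have hsum : ∀ p : ℝ × (Fin (n + 1) → ℝ × ℝ),
      stCumReg p.1 (fun t => if h : t < n + 1 then p.2 ⟨t, h⟩ else 0) (n + 1) =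
        ∑ t ∈ Finset.range (n + 1), roundReg t p := fun p => rfl
  simp only [hsum]
  rw [integral_finsetSum _ fun t ht => integrable_roundReg (Finset.mem_range.1 ht)]
  have hround : ∀ t ∈ Finset.range (n + 1), stdPdf 2 ^ 2 / (2 * 102400 ^ 3) / Real.log (n + 1) ^ 6 ≤
      ∫ p, roundReg t p
        ∂(uniformState.prod (Measure.pi fun _ : Fin (n + 1) => stdNormal2)) := fun t ht =>
    integral_roundReg_ge (by omega : 1 ≤ n) ⟨t, Finset.mem_range.1 ht⟩
  refine le_trans (le_of_eq ?_) (Finset.card_nsmul_le_sum _ _ _ hround)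
  rw [Finset.card_range, nsmul_eq_mul, show (6 : ℝ) = ((6 : ℕ) : ℝ) by norm_num,
    Real.rpow_natCast]
  push_cast
  ring

end
end

section
/- Upper bound on regret per round under the ternary policy: for every constant C_ε > 0 there exists a constant C_regt > 0 depending only on C_ε such that in the per-round ternary-policy model with ε = C_ε · w, the expected per-round regret satisfies E[reg] ≤ C_regt · w², for all θ, l, u with -1 ≤ l ≤ θ ≤ u ≤ 1 and w = u - l > 0. -/
open MeasureTheory ProbabilityTheory Set

noncomputable section

/-- Recommender's message under the ternary policy with tolerance `ε`. -/
def aTer (m ε x z : ℝ) : ℝ :=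
  if ε < x * m + z then 1 else if |x * m + z| < ε then 0 else -1

/-- User's posterior mean of the dynamic payoff under the ternary policy. -/
def ZTer (m ε x z : ℝ) : ℝ :=
  if ε < x * m + z then truncMeanAbove (-(x * m) + ε)
  else if |x * m + z| < ε then truncMeanBetween (-(x * m) - ε) (-(x * m) + ε)
  else truncMeanBelow (-(x * m) - ε)

/-- User's action under the ternary policy. -/
def bTer (θ m ε x z : ℝ) : ℝ := if 0 < x * θ + ZTer m ε x z then 1 else -1

/-- Per-round regret under the ternary policy. -/
def regTer (θ m ε x z : ℝ) : ℝ := if bTer θ m ε x z = bStar θ x z then 0 else |x * θ + z|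

/-- One-step update of the confidence interval under the ternary policy with
tolerance `ε = Cε * (u - l)`. -/
def updTer (θ Cε l u x z : ℝ) : ℝ × ℝ :=
  if bTer θ ((l + u) / 2) (Cε * (u - l)) x z * sgn x < 0 then
    (l, min u (-(ZTer ((l + u) / 2) (Cε * (u - l)) x z / x)))
  else
    (max l (-(ZTer ((l + u) / 2) (Cε * (u - l)) x z / x)), u)

lemma hasDerivAt_stdPdf (z : ℝ) : HasDerivAt stdPdf (-z * stdPdf z) z := by
  have h : HasDerivAt (fun y : ℝ => -y ^ 2 / 2) (-z) z := by
    refine ((hasDerivAt_pow 2 z).fun_neg.div_const 2).congr_deriv ?_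
    norm_num
    ring
  refine (h.exp.div_const (Real.sqrt (2 * Real.pi))).congr_deriv ?_
  simp only [stdPdf]
  ring

lemma integrable_pow_mul_stdPdf (n : ℕ) : Integrable (fun z : ℝ => z ^ n * stdPdf z) := by
  have h := (integrable_rpow_mul_exp_neg_mul_sq (b := 1 / 2) (by norm_num) (s := n)
    (by linarith [(Nat.cast_nonneg n : (0 : ℝ) ≤ n)])).div_const (Real.sqrt (2 * Real.pi))
  refine h.congr (Filter.Eventually.of_forall fun z => ?_)
  have e : -(1 / 2) * z ^ 2 = -z ^ 2 / 2 := by ring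
  simp only [Real.rpow_natCast, stdPdf, e]
  ring

lemma integrable_polynomial_mul_stdPdf (q : Polynomial ℝ) :
    Integrable (fun z : ℝ => q.eval z * stdPdf z) := by
  induction q using Polynomial.induction_on' with
  | add p q hp hq =>
    simp only [Polynomial.eval_add, add_mul]
    exact hp.add hq
  | monomial n a => simpa [mul_assoc] using (integrable_pow_mul_stdPdf n).const_mul a

/-- Gaussian integration by parts on a half-line. -/
lemma integral_Ioi_stein (q : Polynomial ℝ) (c : ℝ) :
    ∫ z in Ioi c, (q.derivative - Polynomial.X * q).eval z * stdPdf z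
      = -(q.eval c * stdPdf c) := by
  have hd : ∀ z : ℝ, HasDerivAt (fun z => q.eval z * stdPdf z)
      ((q.derivative - Polynomial.X * q).eval z * stdPdf z) z := by
    intro z
    refine ((q.hasDerivAt z).mul (hasDerivAt_stdPdf z)).congr_deriv ?_
    simp only [Polynomial.eval_sub, Polynomial.eval_mul, Polynomial.eval_X]
    ring
  have hi := (integrable_polynomial_mul_stdPdf
    (q.derivative - Polynomial.X * q)).integrableOn (s := Ioi c)
  have ht := tendsto_zero_of_hasDerivAt_of_integrableOn_Ioi (fun z _ => hd z) hi
    (integrable_polynomial_mul_stdPdf q).integrableOn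
  rw [integral_Ioi_of_hasDerivAt_of_tendsto (hd c).continuousAt.continuousWithinAt
    (fun z _ => hd z) hi ht, zero_sub]

lemma integral_Ioi_stdPdf_pos (c : ℝ) : 0 < ∫ z in Ioi c, stdPdf z := by
  rw [setIntegral_pos_iff_support_of_nonneg_ae
    (Filter.Eventually.of_forall fun z => (stdPdf_pos z).le) integrable_stdPdf.integrableOn]
  have : Function.support stdPdf = univ := by
    ext z
    simp [(stdPdf_pos z).ne']
  simp [this]

/-- Lower bound on the mean excess of a truncated standard normal, obtained by integrating
`(z - c) * (1 - (z - c) / (1 + |c|)) ^ 2 ≥ 0` by parts. -/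
lemma truncMeanAbove_sub_ge (c : ℝ) : 1 / (6 * (1 + |c|)) ≤ truncMeanAbove c - c := by
  have hc : 0 < 1 + |c| := by positivity
  set a : ℝ := (1 + |c|)⁻¹ with ha
  have ha0 : 0 < a := by positivity
  have hac : a * (1 + |c|) = 1 := inv_mul_cancel₀ hc.ne'
  set P := ∫ z in Ioi c, stdPdf z with hP
  set M := ∫ z in Ioi c, z * stdPdf z with hM
  have hPpos : 0 < P := integral_Ioi_stdPdf_pos c
  let q : Polynomial ℝ := Polynomial.C (-(2 * a + c * a ^ 2)) * (Polynomial.X - Polynomial.C c)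
    + Polynomial.C (a ^ 2) * (Polynomial.X - Polynomial.C c) ^ 2
  have hq : ∫ z in Ioi c, (q.derivative - Polynomial.X * q).eval z * stdPdf z = 0 := by
    rw [integral_Ioi_stein]
    simp [q]
  have hiq := (integrable_polynomial_mul_stdPdf
    (q.derivative - Polynomial.X * q)).integrableOn (s := Ioi c)
  set K : ℝ := 1 + 2 * a * c + 2 * a ^ 2 + a ^ 2 * c ^ 2 with hK
  set N : ℝ := 2 * a + a ^ 2 * c with hN
  have hiM : IntegrableOn (fun z => z * stdPdf z) (Ioi c) := by
    simpa using (integrable_pow_mul_stdPdf 1).integrableOn (s := Ioi c)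
  have hiP : IntegrableOn stdPdf (Ioi c) := integrable_stdPdf.integrableOn
  have hlin : ∫ z in Ioi c, (K * (z * stdPdf z) - (K * c + N) * stdPdf z)
      = K * M - (K * c + N) * P := by
    rw [integral_sub (hiM.const_mul K) (hiP.const_mul _), integral_const_mul, integral_const_mul]
  have hnonneg : 0 ≤ K * M - (K * c + N) * P := by
    rw [← hlin, ← hq]
    refine setIntegral_mono_on hiq ((hiM.const_mul K).sub (hiP.const_mul _)) measurableSet_Ioi ?_
    intro z hz
    have hz' : 0 ≤ z - c := by
      have : c < z := hz
      linarith
    have hsq : 0 ≤ ((z - c) * (1 - a * (z - c)) ^ 2) * stdPdf z := by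
      have := stdPdf_pos z
      positivity
    have : (q.derivative - Polynomial.X * q).eval z * stdPdf z
        + ((z - c) * (1 - a * (z - c)) ^ 2) * stdPdf z
        = K * (z * stdPdf z) - (K * c + N) * stdPdf z := by
      simp only [q, hK, hN, Polynomial.derivative_add, Polynomial.derivative_C_mul,
        Polynomial.derivative_X_sub_C, Polynomial.derivative_X_sub_C_sq, Polynomial.eval_add,
        Polynomial.eval_sub, Polynomial.eval_mul, Polynomial.eval_pow, Polynomial.eval_C,
        Polynomial.eval_X, Polynomial.eval_one]
      ring
    linarith
  have habs : a * |c| ≤ 1 := by nlinarith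
  have ha1 : a ≤ 1 := by nlinarith [abs_nonneg c]
  have hacl : -1 ≤ a * c := by nlinarith [neg_abs_le c]
  have hacu : a * c ≤ 1 := by nlinarith [le_abs_self c]
  have hK6 : K ≤ 6 := by nlinarith
  have hNa : a ≤ N := by nlinarith
  have hmean : truncMeanAbove c = M / P := rfl
  have hexc : N ≤ K * (truncMeanAbove c - c) := by
    have : K * (truncMeanAbove c - c) - N = (K * M - (K * c + N) * P) / P := by
      rw [hmean]
      field_simp
      ring
    have := div_nonneg hnonneg hPpos.le
    linarith
  have hKpos : 0 < K := by nlinarith [sq_nonneg (1 + a * c), sq_pos_of_pos ha0]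
  have hpos : 0 < truncMeanAbove c - c := by
    by_contra! h
    nlinarith
  have : 1 / (6 * (1 + |c|)) = a / 6 := by
    rw [ha]
    field_simp
  rw [this]
  nlinarith

lemma bTer_eq_bStar_of_lt {θ m ε x z : ℝ} (hε : 0 ≤ ε)
    (hD : ε + |x * (θ - m)| < |x * m + z|)
    (hx : 6 * (1 + (|x * m| + ε)) * |x * (θ - m)| < 1) :
    bTer θ m ε x z = bStar θ x z := by
  have hexc : ∀ c, |c| ≤ |x * m| + ε → |x * (θ - m)| < truncMeanAbove c - c := by
    intro c hc
    refine lt_of_lt_of_le ?_ (truncMeanAbove_sub_ge c)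
    rw [lt_div_iff₀ (by positivity)]
    nlinarith [abs_nonneg (x * (θ - m))]
  have hl := neg_abs_le (x * (θ - m))
  have hu := le_abs_self (x * (θ - m))
  rcases le_or_gt 0 (x * m + z) with h | h
  · rw [abs_of_nonneg h] at hD
    have hb : 0 < x * θ + z := by nlinarith
    have hε' : ε < x * m + z := by nlinarith [abs_nonneg (x * (θ - m))]
    have hZ := hexc (-(x * m) + ε) (by
      simpa [abs_of_nonneg hε] using abs_add_le (-(x * m)) ε)
    have : 0 < x * θ + truncMeanAbove (-(x * m) + ε) := by nlinarith
    simp [bTer, bStar, ZTer, hε', hb, this]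
  · rw [abs_of_neg h] at hD
    have hb : ¬ 0 < x * θ + z := by nlinarith
    have hε1 : ¬ ε < x * m + z := by linarith
    have hε2 : ¬ |x * m + z| < ε := by
      rw [abs_of_neg h]
      nlinarith [abs_nonneg (x * (θ - m))]
    have hZ := hexc (x * m + ε) (by
      simpa [abs_of_nonneg hε] using abs_add_le (x * m) ε)
    have e : -(-(x * m) - ε) = x * m + ε := by ring
    have : ¬ 0 < x * θ + truncMeanBelow (-(x * m) - ε) := by
      rw [truncMeanBelow_eq_neg, e]
      nlinarith
    simp only [bTer, bStar, ZTer, if_neg hε1, if_neg hε2, if_neg hb, if_neg this]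

lemma regTer_nonneg (θ m ε x z : ℝ) : 0 ≤ regTer θ m ε x z := by
  unfold regTer
  split_ifs <;> positivity

/-- The regret is either of order `w` on an event of probability of order `w`, or incurred at a
context `x` for which `(1 + |x|) ^ 2 * w` is bounded below. -/
lemma regTer_le {C w θ m x z : ℝ} (hC : 0 < C) (hw : 0 < w) (hw2 : w ≤ 2) (hm : |m| ≤ 1)
    (hθ : |θ| ≤ 1) (hθm : |θ - m| ≤ w / 2) :
    regTer θ m (C * w) x z ≤
      (Icc (-(x * θ) - (C + 1) * w * (1 + |x|)) (-(x * θ) + (C + 1) * w * (1 + |x|))).indicator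
        (fun _ => (C + 1) * w * (1 + |x|)) z
      + (3 * (1 + 2 * C) * w) ^ 2 * ((1 + |x|) ^ 5 * (1 + |z|) ^ 1) := by
  have hx0 := abs_nonneg x
  have hz0 := abs_nonneg z
  have hind : 0 ≤ (Icc (-(x * θ) - (C + 1) * w * (1 + |x|))
      (-(x * θ) + (C + 1) * w * (1 + |x|))).indicator
        (fun _ => (C + 1) * w * (1 + |x|)) z := indicator_nonneg (fun _ _ => by positivity) z
  have hrest : 0 ≤ (3 * (1 + 2 * C) * w) ^ 2 * ((1 + |x|) ^ 5 * (1 + |z|) ^ 1) := by positivity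
  by_cases hb : bTer θ m (C * w) x z = bStar θ x z
  · rw [regTer, if_pos hb]
    positivity
  rw [regTer, if_neg hb]
  have hδ : |x * (θ - m)| ≤ |x| * (w / 2) := by
    rw [abs_mul]
    gcongr
  by_cases hT : |x * θ + z| ≤ (C + 1) * w * (1 + |x|)
  · rw [indicator_of_mem (by
      have := abs_le.mp hT
      constructor <;> linarith)]
    linarith
  push Not at hT
  have hD : C * w + |x * (θ - m)| < |x * m + z| := by
    have h1 : |x * θ + z| ≤ |x * m + z| + |x * (θ - m)| := by
      calc |x * θ + z| = |(x * m + z) + x * (θ - m)| := by ring_nf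
        _ ≤ _ := abs_add_le _ _
    nlinarith [mul_nonneg hC.le (mul_nonneg hw.le hx0)]
  have hbig : 1 ≤ 3 * (1 + 2 * C) * w * (1 + |x|) ^ 2 := by
    by_contra! hlt
    refine hb (bTer_eq_bStar_of_lt (by positivity) hD (lt_of_le_of_lt ?_ hlt))
    have hxm : |x * m| ≤ |x| := by
      rw [abs_mul]
      exact mul_le_of_le_one_right hx0 hm
    have h1 : 1 + (|x * m| + C * w) ≤ (1 + 2 * C) * (1 + |x|) := by
      nlinarith [mul_nonneg hC.le hx0]
    have h2 : |x * (θ - m)| ≤ (1 + |x|) * (w / 2) := by nlinarith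
    calc 6 * (1 + (|x * m| + C * w)) * |x * (θ - m)|
        ≤ 6 * ((1 + 2 * C) * (1 + |x|)) * ((1 + |x|) * (w / 2)) := by gcongr
      _ = 3 * (1 + 2 * C) * w * (1 + |x|) ^ 2 := by ring
  have hxz : |x * θ + z| ≤ (1 + |x|) * (1 + |z|) := by
    have h1 := abs_add_le (x * θ) z
    have h2 : |x * θ| ≤ |x| := by
      rw [abs_mul]
      exact mul_le_of_le_one_right hx0 hθ
    nlinarith [mul_nonneg hx0 hz0]
  have hsq : 1 ≤ (3 * (1 + 2 * C) * w * (1 + |x|) ^ 2) ^ 2 := one_le_pow₀ hbig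
  calc |x * θ + z| ≤ 1 * ((1 + |x|) * (1 + |z|)) := by linarith
    _ ≤ (3 * (1 + 2 * C) * w * (1 + |x|) ^ 2) ^ 2 * ((1 + |x|) * (1 + |z|)) := by gcongr
    _ = (3 * (1 + 2 * C) * w) ^ 2 * ((1 + |x|) ^ 5 * (1 + |z|) ^ 1) := by ring
    _ ≤ _ := by linarith

lemma integrable_one_add_abs_pow (n : ℕ) : Integrable (fun x : ℝ => (1 + |x|) ^ n) stdNormal := by
  rcases eq_or_ne n 0 with rfl | hn
  · simp
  have hid : MemLp (id : ℝ → ℝ) n stdNormal := by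
    simpa [stdNormal] using memLp_id_gaussianReal (μ := 0) (v := 1) (n : NNReal)
  have hone : MemLp (fun _ : ℝ => (1 : ℝ)) n stdNormal := memLp_const 1
  have h := (hone.add hid.norm).integrable_norm_pow hn
  refine h.congr (Filter.Eventually.of_forall fun x => ?_)
  have : 0 ≤ 1 + |x| := by positivity
  simp only [Pi.add_apply, id_eq, Real.norm_eq_abs, abs_of_nonneg this]

lemma stdNormal_le_volume (s : Set ℝ) : stdNormal s ≤ volume s := by
  rw [stdNormal, gaussianReal_apply 0 one_ne_zero]
  calc ∫⁻ x in s, gaussianPDF 0 1 x ≤ ∫⁻ _ in s, 1 := by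
        refine lintegral_mono fun x => ?_
        rw [gaussianPDF, ENNReal.ofReal_le_one, gaussianPDFReal]
        refine mul_le_one₀ (inv_le_one_of_one_le₀ ?_) (Real.exp_nonneg _) ?_
        · rw [Real.one_le_sqrt]
          simp only [NNReal.coe_one]
          nlinarith [Real.pi_gt_three]
        · rw [Real.exp_le_one_iff]
          simp only [NNReal.coe_one]
          nlinarith [sq_nonneg (x - 0)]
    _ = volume s := by simp

lemma stdNormal_real_Icc_le {a b : ℝ} (hab : a ≤ b) : stdNormal.real (Icc a b) ≤ b - a := by
  refine ENNReal.toReal_le_of_le_ofReal (by linarith) ?_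
  simpa using stdNormal_le_volume (Icc a b)

/-- A loss of size `k * (1 + |x|)` incurred when `z` falls in a window of that radius has mean of
order `k ^ 2`. -/
lemma integral_window_le (θ : ℝ) {k : ℝ} (hk : 0 ≤ k) :
    Integrable (fun p : ℝ × ℝ =>
      (Icc (-(p.1 * θ) - k * (1 + |p.1|)) (-(p.1 * θ) + k * (1 + |p.1|))).indicator
        (fun _ => k * (1 + |p.1|)) p.2) stdNormal2 ∧
    ∫ p : ℝ × ℝ, (Icc (-(p.1 * θ) - k * (1 + |p.1|)) (-(p.1 * θ) + k * (1 + |p.1|))).indicator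
        (fun _ => k * (1 + |p.1|)) p.2 ∂stdNormal2
      ≤ 2 * k ^ 2 * ∫ x, (1 + |x|) ^ 2 ∂stdNormal := by
  let S : Set (ℝ × ℝ) := {p | -(p.1 * θ) - k * (1 + |p.1|) ≤ p.2} ∩
    {p | p.2 ≤ -(p.1 * θ) + k * (1 + |p.1|)}
  have hS : MeasurableSet S := by
    refine MeasurableSet.inter (measurableSet_le ?_ ?_) (measurableSet_le ?_ ?_) <;> fun_prop
  have hint : Integrable (fun p : ℝ × ℝ =>
      (Icc (-(p.1 * θ) - k * (1 + |p.1|)) (-(p.1 * θ) + k * (1 + |p.1|))).indicator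
        (fun _ => k * (1 + |p.1|)) p.2) stdNormal2 := by
    have h1 : Integrable (fun p : ℝ × ℝ => k * (1 + |p.1|)) stdNormal2 := by
      have h := (integrable_one_add_abs_pow 1).const_mul k
      simp only [pow_one] at h
      exact h.comp_fst stdNormal
    exact h1.indicator hS
  refine ⟨hint, ?_⟩
  rw [stdNormal2, integral_prod _ hint, ← integral_const_mul]
  refine integral_mono_of_nonneg (Filter.Eventually.of_forall fun x => ?_)
    ((integrable_one_add_abs_pow 2).const_mul _) (Filter.Eventually.of_forall fun x => ?_)
  · exact integral_nonneg fun z => indicator_nonneg (fun _ _ => by positivity) z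
  · have hT : 0 ≤ k * (1 + |x|) := by positivity
    simp only [integral_indicator_const _ measurableSet_Icc, smul_eq_mul]
    calc _ ≤ ((-(x * θ) + k * (1 + |x|)) - (-(x * θ) - k * (1 + |x|))) * (k * (1 + |x|)) := by
          gcongr
          exact stdNormal_real_Icc_le (by linarith)
      _ = 2 * k ^ 2 * (1 + |x|) ^ 2 := by ring

/-- **Upper bound on regret per round under the ternary policy.** For every
`Cε > 0` there is a constant `C_regt > 0` depending only on `Cε` such that, with
`ε = Cε * w`, the expected per-round regret is at most `C_regt * w²`. -/
theorem ternary_per_round_regret_upper_bound :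
    ∀ Cε : ℝ, 0 < Cε →
      ∃ Cregt : ℝ, 0 < Cregt ∧
        ∀ θ l u : ℝ, -1 ≤ l → l ≤ θ → θ ≤ u → u ≤ 1 → l < u →
          ∫ p : ℝ × ℝ, regTer θ ((l + u) / 2) (Cε * (u - l)) p.1 p.2 ∂stdNormal2 ≤
            Cregt * (u - l) ^ 2 := by
  intro C hC
  have hM : ∀ n, 0 ≤ ∫ x : ℝ, (1 + |x|) ^ n ∂stdNormal := fun n =>
    integral_nonneg fun x => by positivity
  refine ⟨2 * (C + 1) ^ 2 * (∫ x, (1 + |x|) ^ 2 ∂stdNormal) + (3 * (1 + 2 * C)) ^ 2 *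
    ((∫ x, (1 + |x|) ^ 5 ∂stdNormal) * ∫ x, (1 + |x|) ^ 1 ∂stdNormal) + 1, ?_, ?_⟩
  · have h1 := hM 1
    have h2 := hM 2
    have h5 := hM 5
    positivity
  intro θ l u hl hlθ hθu hu hlu
  have hw : 0 < u - l := by linarith
  obtain ⟨hI, hI'⟩ := integral_window_le θ (k := (C + 1) * (u - l)) (by positivity)
  have hJ := ((integrable_one_add_abs_pow 5).mul_prod (integrable_one_add_abs_pow 1)).const_mul
    ((3 * (1 + 2 * C) * (u - l)) ^ 2)
  have hmono := integral_mono_of_nonneg (μ := stdNormal2)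
    (Filter.Eventually.of_forall fun p : ℝ × ℝ =>
      regTer_nonneg θ ((l + u) / 2) (C * (u - l)) p.1 p.2)
    (hI.add hJ) (Filter.Eventually.of_forall fun p : ℝ × ℝ =>
      regTer_le (x := p.1) (z := p.2) hC hw (by linarith)
        (abs_le.mpr ⟨by linarith, by linarith⟩) (abs_le.mpr ⟨by linarith, by linarith⟩)
        (abs_le.mpr ⟨by linarith, by linarith⟩))
  refine hmono.trans ?_
  simp only [Pi.add_apply]
  rw [integral_add hI hJ, integral_const_mul, stdNormal2, integral_prod_mul
    (fun x : ℝ => (1 + |x|) ^ 5) (fun z : ℝ => (1 + |z|) ^ 1)]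
  rw [stdNormal2] at hI'
  nlinarith [sq_nonneg (u - l)]

end
end
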